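/- For all spherical configurations P₁, …, P_n on S^d, the spherical independence density is supermultiplicative: m_{S^d}(P₁, …, P_n) ≥ ∏_{i=1}^n m_{S^d}(P_i). Concretely: if for each i, A_i ⊆ S^d is measurable and contains no congruent copy of P_i, then there exist rotations R₁,…,R_n ∈ O(d+1) such that σ(⋂_{i=1}^n R_i A_i) ≥ ∏_{i=1}^n σ(A_i), and this intersection avoids all P_i. -/

import Mathlib

open MeasureTheory Filter

noncomputable section

/-- Borel σ-algebra on real matrices. -/
instance matMeasurableSpace {d : ℕ} : MeasurableSpace (Matrix (Fin d) (Fin d) ℝ) := borel _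

/-- The action of an orthogonal matrix on Euclidean space. -/
def act {d : ℕ} (T : Matrix.orthogonalGroup (Fin d) ℝ)
    (v : EuclideanSpace ℝ (Fin d)) : EuclideanSpace ℝ (Fin d) :=
  (EuclideanSpace.equiv (Fin d) ℝ).symm
    ((T : Matrix (Fin d) (Fin d) ℝ).mulVec (EuclideanSpace.equiv (Fin d) ℝ v))

/-- The unit sphere `S^d ⊂ ℝ^{d+1}`. -/
def unitSphere (d : ℕ) : Set (EuclideanSpace ℝ (Fin (d + 1))) :=
  Metric.sphere (0 : EuclideanSpace ℝ (Fin (d + 1))) 1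

/-- Closed spherical cap of Euclidean radius `ρ` centered at `x`. -/
def scap {d : ℕ} (x : EuclideanSpace ℝ (Fin (d + 1))) (ρ : ℝ) :
    Set (EuclideanSpace ℝ (Fin (d + 1))) :=
  {y | y ∈ unitSphere d ∧ dist x y ≤ ρ}

lemma act_mul {d : ℕ} (S T : Matrix.orthogonalGroup (Fin d) ℝ) (v : EuclideanSpace ℝ (Fin d)) :
    act (S * T) v = act S (act T v) := by
  simp only [act, ContinuousLinearEquiv.apply_symm_apply, Matrix.mulVec_mulVec]
  rfl

lemma act_one {d : ℕ} (v : EuclideanSpace ℝ (Fin d)) :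
    act (1 : Matrix.orthogonalGroup (Fin d) ℝ) v = v := by
  simp [act]

lemma act_image {d : ℕ} (T : Matrix.orthogonalGroup (Fin d) ℝ)
    (B : Set (EuclideanSpace ℝ (Fin d))) : act T '' B = act T⁻¹ ⁻¹' B := by
  ext v
  constructor
  · rintro ⟨w, hw, rfl⟩
    simpa [← act_mul, act_one] using hw
  · intro h
    exact ⟨_, h, by rw [← act_mul, mul_inv_cancel, act_one]⟩

lemma act_transitive {d : ℕ} (x y : EuclideanSpace ℝ (Fin d)) (h : ‖x‖ = ‖y‖) :
    ∃ T : Matrix.orthogonalGroup (Fin d) ℝ, act T x = y := by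
  let f : EuclideanSpace ℝ (Fin d) ≃ₗᵢ[ℝ] EuclideanSpace ℝ (Fin d) :=
    (Submodule.reflection (Submodule.span ℝ {x - y})ᗮ)
  let b := EuclideanSpace.basisFun (Fin d) ℝ
  refine ⟨⟨f.toMatrix b.toBasis b.toBasis, f.toMatrix_mem_unitaryGroup b b⟩, ?_⟩
  have hf : f x = y := Submodule.reflection_sub h
  have := LinearMap.toMatrix_mulVec_repr b.toBasis b.toBasis (f.toLinearEquiv : EuclideanSpace ℝ (Fin d) →ₗ[ℝ] EuclideanSpace ℝ (Fin d)) x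
  ext i
  have h2 := congrFun this i
  simp [b] at h2
  rw [← hf]
  exact h2

instance matBorel {d : ℕ} : BorelSpace (Matrix (Fin d) (Fin d) ℝ) := ⟨rfl⟩

instance matSC {d : ℕ} : SecondCountableTopology (Matrix (Fin d) (Fin d) ℝ) :=
  inferInstanceAs (SecondCountableTopology (Fin d → Fin d → ℝ))

lemma og_compact (d : ℕ) : CompactSpace (Matrix.orthogonalGroup (Fin d) ℝ) := by
  refine isCompact_iff_compactSpace.1 (?_ : IsCompact (Matrix.orthogonalGroup (Fin d) ℝ : Set (Matrix (Fin d) (Fin d) ℝ)))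
  have hc : IsCompact (Set.pi Set.univ fun _ : Fin d => Set.pi Set.univ fun _ : Fin d =>
      Set.Icc (-1 : ℝ) 1) :=
    isCompact_univ_pi fun _ => isCompact_univ_pi fun _ => isCompact_Icc
  refine IsCompact.of_isClosed_subset (X := Matrix (Fin d) (Fin d) ℝ) hc
    (isClosed_unitary (R := Matrix (Fin d) (Fin d) ℝ)) ?_
  intro M hM i _ j _
  have := entry_norm_bound_of_unitary (𝕜 := ℝ) hM i j
  rw [Real.norm_eq_abs, abs_le] at this
  exact this

lemma act_continuous {d : ℕ} : Continuous
    (fun p : Matrix.orthogonalGroup (Fin d) ℝ × EuclideanSpace ℝ (Fin d) => act p.1⁻¹ p.2) := by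
  unfold act
  refine (EuclideanSpace.equiv (Fin d) ℝ).symm.continuous.comp ?_
  refine Continuous.matrix_mulVec ?_ ?_
  · exact continuous_subtype_val.comp (continuous_inv.comp continuous_fst)
  · exact (EuclideanSpace.equiv (Fin d) ℝ).continuous.comp continuous_snd

lemma act_measurable {d : ℕ} (T : Matrix.orthogonalGroup (Fin d) ℝ) : Measurable (act T) := by
  have : Continuous (act T) := by
    have := act_continuous.comp (Continuous.prodMk_right (Y := EuclideanSpace ℝ (Fin d)) T⁻¹)
    simpa [Function.comp_def] using this
  exact this.measurable

lemma two_sets {d : ℕ}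
    (σ : Measure (EuclideanSpace ℝ (Fin (d + 1)))) [IsProbabilityMeasure σ]
    (hσs : σ (unitSphere d) = 1)
    (hσinv : ∀ T : Matrix.orthogonalGroup (Fin (d + 1)) ℝ, σ.map (act T) = σ)
    (A B : Set (EuclideanSpace ℝ (Fin (d + 1)))) (hA : MeasurableSet A) (hB : MeasurableSet B) :
    ∃ R : Matrix.orthogonalGroup (Fin (d + 1)) ℝ, σ A * σ B ≤ σ (A ∩ act R '' B) := by
  haveI := og_compact (d + 1)
  let G := Matrix.orthogonalGroup (Fin (d + 1)) ℝ
  let μ : Measure G := Measure.haarMeasure ⊤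
  haveI : IsProbabilityMeasure μ := ⟨by
    have := Measure.haarMeasure_self (K₀ := (⊤ : TopologicalSpace.PositiveCompacts G))
    simpa using this⟩
  let f : EuclideanSpace ℝ (Fin (d + 1)) → ENNReal := fun x => μ {R | act R⁻¹ x ∈ B}
  have hmeas : Measurable
      (fun p : G × EuclideanSpace ℝ (Fin (d + 1)) => act p.1⁻¹ p.2) := act_continuous.measurable
  have key : ∀ C, MeasurableSet C →
      ∫⁻ R, σ (C ∩ act R⁻¹ ⁻¹' B) ∂μ = ∫⁻ x in C, f x ∂σ := by
    intro C hC
    have hS : MeasurableSet {p : G × EuclideanSpace ℝ (Fin (d + 1)) | p.2 ∈ C ∧ act p.1⁻¹ p.2 ∈ B} :=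
      (measurable_snd hC).inter (hmeas hB)
    have h1 := Measure.prod_apply (μ := μ) (ν := σ) hS
    have h2 := Measure.prod_apply_symm (μ := μ) (ν := σ) hS
    rw [h1] at h2
    refine h2.trans ?_
    rw [← lintegral_indicator hC]
    refine lintegral_congr fun x => ?_
    by_cases hx : x ∈ C <;> simp [hx, f]
  have hinv : ∀ (T : G) x, f (act T x) = f x := by
    intro T x
    have h := measure_preimage_mul μ T⁻¹ {R | act R⁻¹ x ∈ B}
    simp only [f]
    rw [← h]
    congr 1
    ext R
    simp [act_mul]
  obtain ⟨x₀, hx₀⟩ : (unitSphere d).Nonempty := by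
    rw [Set.nonempty_iff_ne_empty]
    intro h
    simp [h] at hσs
  have hconst : ∀ x ∈ unitSphere d, f x = f x₀ := by
    intro x hx
    have h1 : ‖x₀‖ = 1 := by simpa [unitSphere] using hx₀
    have h2 : ‖x‖ = 1 := by simpa [unitSphere] using hx
    obtain ⟨T, rfl⟩ := act_transitive x₀ x (by rw [h1, h2])
    exact hinv T x₀
  have hae : ∀ᵐ x ∂σ, x ∈ unitSphere d := by
    have hm : MeasurableSet (unitSphere d) := Metric.isClosed_sphere.measurableSet
    rw [← mem_ae_iff_prob_eq_one hm] at hσs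
    exact hσs
  have hint : ∀ C, ∫⁻ x in C, f x ∂σ = f x₀ * σ C := by
    intro C
    rw [← setLIntegral_const]
    refine lintegral_congr_ae (ae_restrict_of_ae ?_)
    filter_upwards [hae] with x hx using hconst x hx
  have hc : f x₀ = σ B := by
    have h1 := key Set.univ MeasurableSet.univ
    rw [hint] at h1
    have h2 : ∀ R : G, σ (Set.univ ∩ act R⁻¹ ⁻¹' B) = σ B := by
      intro R
      rw [Set.univ_inter, ← Measure.map_apply (act_measurable _) hB, hσinv]
    simp only [h2] at h1
    simpa using h1.symm
  obtain ⟨R, hR⟩ := exists_lintegral_le (μ := μ) (f := fun R : G => σ (A ∩ act R⁻¹ ⁻¹' B)) (by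
    rw [key A hA, hint, hc]
    exact ENNReal.mul_ne_top (measure_ne_top _ _) (measure_ne_top _ _))
  refine ⟨R, ?_⟩
  rw [key A hA, hint, hc] at hR
  rw [act_image, mul_comm]
  exact hR

lemma many_sets {d : ℕ}
    (σ : Measure (EuclideanSpace ℝ (Fin (d + 1)))) [IsProbabilityMeasure σ]
    (hσs : σ (unitSphere d) = 1)
    (hσinv : ∀ T : Matrix.orthogonalGroup (Fin (d + 1)) ℝ, σ.map (act T) = σ) (n : ℕ)
    (A : Fin n → Set (EuclideanSpace ℝ (Fin (d + 1)))) (hA : ∀ i, MeasurableSet (A i)) :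
    ∃ Rot : Fin n → Matrix.orthogonalGroup (Fin (d + 1)) ℝ,
      (∏ i, σ (A i)) ≤ σ (⋂ i, act (Rot i) '' A i) := by
  induction n with
  | zero => exact ⟨fun _ => 1, by simp⟩
  | succ n ih =>
    obtain ⟨Rot, h⟩ := ih (fun i => A i.succ) (fun i => hA _)
    have hm : MeasurableSet (⋂ i, act (Rot i) '' A i.succ) :=
      MeasurableSet.iInter fun i => by
        rw [act_image]
        exact act_measurable _ (hA _)
    obtain ⟨R, hR⟩ := two_sets σ hσs hσinv _ (A 0) hm (hA 0)
    refine ⟨Fin.cons R Rot, ?_⟩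
    rw [Fin.prod_univ_succ, mul_comm]
    refine (mul_le_mul_left h _).trans (hR.trans (measure_mono ?_))
    rintro x ⟨hx, hx0⟩
    rw [Set.mem_iInter] at hx ⊢
    intro i
    refine Fin.cases ?_ (fun j => ?_) i
    · simpa using hx0
    · simpa using hx j

/-- supermultiplicativity of the spherical independence density, in the concrete
form used in its proof: suitable rotations make the intersection large while avoiding all
configurations. -/
theorem stmt_5 {d n : ℕ}
    (σ : Measure (EuclideanSpace ℝ (Fin (d + 1)))) (hσ : IsProbabilityMeasure σ)
    (hσs : σ (unitSphere d) = 1)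
    (hσinv : ∀ T : Matrix.orthogonalGroup (Fin (d + 1)) ℝ, σ.map (act T) = σ)
    (P A : Fin n → Set (EuclideanSpace ℝ (Fin (d + 1))))
    (hPfin : ∀ i, (P i).Finite) (hPs : ∀ i, P i ⊆ unitSphere d)
    (hAs : ∀ i, A i ⊆ unitSphere d) (hAm : ∀ i, MeasurableSet (A i))
    (hav : ∀ i, ¬ ∃ T : Matrix.orthogonalGroup (Fin (d + 1)) ℝ, act T '' P i ⊆ A i) :
    ∃ Rot : Fin n → Matrix.orthogonalGroup (Fin (d + 1)) ℝ,
      (∏ i, σ (A i)) ≤ σ (⋂ i, act (Rot i) '' A i) ∧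
      ∀ i, ¬ ∃ T : Matrix.orthogonalGroup (Fin (d + 1)) ℝ,
        act T '' P i ⊆ ⋂ j, act (Rot j) '' A j := by
  obtain ⟨Rot, h⟩ := many_sets σ hσs hσinv n A hAm
  refine ⟨Rot, h, ?_⟩
  rintro i ⟨T, hT⟩
  refine hav i ⟨(Rot i)⁻¹ * T, ?_⟩
  rintro _ ⟨p, hp, rfl⟩
  have := Set.mem_iInter.1 (hT ⟨p, hp, rfl⟩) i
  rw [act_image] at this
  rw [act_mul]
  exact this
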